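/- Let {M_n} be a family of sets of states satisfying properties 1–5 on the tensor powers of a finite-dimensional Hilbert space ℋ, and let ρ ∈ D(ℋ). If ε > 0 and {A_n} is a sequence of operators with 0 ≤ A_n ≤ I on ℋ^{⊗n} such that for every n and every ω_n ∈ M_n one has −(1/n) log₂ tr(A_n ω_n) − ε ≥ E_M^∞(ρ), then lim_{n→∞} tr((I − A_n) ρ^{⊗n}) = 1. (Strong converse of the generalized quantum Stein's Lemma.) -/

import Mathlib

open scoped BigOperators
open Filter ComplexOrder

noncomputable section

namespace GQSL

variable {I : Type*} [Fintype I] [DecidableEq I]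

/-- A quantum state: a positive semidefinite matrix of unit trace. -/
def IsState (ρ : Matrix I I ℂ) : Prop := ρ.PosSemidef ∧ ρ.trace = 1

/-- The `n`-fold tensor power of an operator, realized on `Fin n → I` indices. -/
def tpow (ρ : Matrix I I ℂ) (n : ℕ) : Matrix (Fin n → I) (Fin n → I) ℂ :=
  fun x y => ∏ i, ρ (x i) (y i)

/-- Functional calculus for Hermitian matrices (junk value `0` otherwise). -/
def fcal (f : ℝ → ℝ) (A : Matrix I I ℂ) : Matrix I I ℂ :=
  if hA : A.IsHermitian then
    (hA.eigenvectorUnitary : Matrix I I ℂ) *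
      Matrix.diagonal (fun i => (f (hA.eigenvalues i) : ℂ)) *
      star (hA.eigenvectorUnitary : Matrix I I ℂ)
  else 0

/-- Base-2 matrix logarithm, computed on the support. -/
def mlog (A : Matrix I I ℂ) : Matrix I I ℂ :=
  fcal (fun x => if 0 < x then Real.logb 2 x else 0) A

/-- Real matrix power, computed on the support (generalized inverse powers). -/
def mpow (A : Matrix I I ℂ) (t : ℝ) : Matrix I I ℂ :=
  fcal (fun x => if 0 < x then x ^ t else 0) A

/-- Matrix square root of a positive semidefinite matrix. -/
def msqrt (A : Matrix I I ℂ) : Matrix I I ℂ := fcal Real.sqrt A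

/-- Trace norm `‖A‖₁ = tr √(AᴴA)`. -/
def trNorm (A : Matrix I I ℂ) : ℝ := ((msqrt (A.conjTranspose * A)).trace).re

/-- Trace of the positive part of a Hermitian matrix: the sum of its positive eigenvalues. -/
def trPos (A : Matrix I I ℂ) : ℝ := ((fcal (fun x => max x 0) A).trace).re

/-- Fidelity `F(A,B) = tr √(√A B √A)`. -/
def fid (A B : Matrix I I ℂ) : ℝ := ((msqrt (msqrt A * B * msqrt A)).trace).re

/-- Von Neumann entropy (base 2). -/
def vnEnt (A : Matrix I I ℂ) : ℝ := -((A * mlog A).trace).re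

/-- `supp ρ ⊆ supp σ`, expressed via kernels. -/
def SuppLe (ρ σ : Matrix I I ℂ) : Prop := ∀ v, σ.mulVec v = 0 → ρ.mulVec v = 0

/-- Quantum relative entropy `S(ρ‖σ) = tr(ρ(log₂ρ − log₂σ))` (finite-value formula,
meaningful when `SuppLe ρ σ` holds). -/
def relEnt (ρ σ : Matrix I I ℂ) : ℝ := ((ρ * (mlog ρ - mlog σ)).trace).re

/-- `E_M(ρ) = inf {S(ρ‖σ) : σ ∈ M}`; states `σ` violating the support condition
have `S(ρ‖σ) = +∞` and hence do not contribute to the infimum. -/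
def EMset (M : Set (Matrix I I ℂ)) (ρ : Matrix I I ℂ) : ℝ :=
  sInf {x | ∃ σ ∈ M, SuppLe ρ σ ∧ x = relEnt ρ σ}

/-- Max-relative entropy `S_max(ρ‖σ) = inf {s : ρ ≤ 2^s σ}`. -/
def Smax (ρ σ : Matrix I I ℂ) : ℝ := sInf {s : ℝ | (((2:ℝ) ^ s) • σ - ρ).PosSemidef}

/-- Log robustness with respect to a set `M`. -/
def LR (M : Set (Matrix I I ℂ)) (ρ : Matrix I I ℂ) : ℝ :=
  sInf {x | ∃ σ ∈ M, x = Smax ρ σ}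

/-- Smoothed log robustness. -/
def LReps (M : Set (Matrix I I ℂ)) (ε : ℝ) (ρ : Matrix I I ℂ) : ℝ :=
  sInf {x | ∃ ρ', IsState ρ' ∧ trNorm (ρ' - ρ) ≤ ε ∧ x = LR M ρ'}

/-- Partial trace over the `k`-th tensor factor. -/
def ptraceAt {n : ℕ} (k : Fin (n + 1)) (ρ : Matrix (Fin (n + 1) → I) (Fin (n + 1) → I) ℂ) :
    Matrix (Fin n → I) (Fin n → I) ℂ :=
  fun x y => ∑ a : I, ρ (k.insertNth a x) (k.insertNth a y)

/-- Tensor product of operators on `n` and `m` copies. -/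
def tprod {n m : ℕ} (ρ : Matrix (Fin n → I) (Fin n → I) ℂ)
    (ν : Matrix (Fin m → I) (Fin m → I) ℂ) :
    Matrix (Fin (n + m) → I) (Fin (n + m) → I) ℂ :=
  fun x y => ρ (fun i => x (Fin.castAdd m i)) (fun i => y (Fin.castAdd m i)) *
    ν (fun j => x (Fin.natAdd n j)) (fun j => y (Fin.natAdd n j))

/-- Conjugation `P_π ρ P_π†` by the permutation unitary. -/
def permute {n : ℕ} (π : Equiv.Perm (Fin n)) (ρ : Matrix (Fin n → I) (Fin n → I) ℂ) :
    Matrix (Fin n → I) (Fin n → I) ℂ :=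
  fun x y => ρ (x ∘ π) (y ∘ π)

/-- A family of sets of states satisfying properties 1–5, with `σ` the fixed
full-rank state of property 2. -/
structure GoodFamily {d : ℕ} (σ : Matrix (Fin d) (Fin d) ℂ)
    (M : ∀ n : ℕ, Set (Matrix (Fin n → Fin d) (Fin n → Fin d) ℂ)) : Prop where
  states : ∀ n, ∀ ρ ∈ M n, IsState ρ
  convex : ∀ n, Convex ℝ (M n)
  closed : ∀ n, IsClosed (M n)
  sigma_state : IsState σ
  sigma_posdef : σ.PosDef
  sigma_mem : ∀ n, tpow σ n ∈ M n
  ptrace_mem : ∀ n (k : Fin (n + 1)), ∀ ρ ∈ M (n + 1), ptraceAt k ρ ∈ M n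
  tprod_mem : ∀ n m, ∀ ρ ∈ M n, ∀ ν ∈ M m, tprod ρ ν ∈ M (n + m)
  perm_mem : ∀ n (π : Equiv.Perm (Fin n)), ∀ ρ ∈ M n, permute π ρ ∈ M n

/-- The rank-one operator `|f⟩⟨f|`. -/
def vecOp {J : Type*} (f : J → ℂ) : Matrix J J ℂ := fun x y => f x * star (f y)

/-- Squared ℓ²-norm of a vector. -/
def vecNormSq {J : Type*} [Fintype J] (f : J → ℂ) : ℝ := ∑ x, Complex.normSq (f x)

/-- ℓ²-norm of a vector. -/
def l2norm {J : Type*} [Fintype J] (f : J → ℂ) : ℝ := Real.sqrt (vecNormSq f)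

/-- Membership in the symmetric subspace. -/
def IsSymVec {J : Type*} {N : ℕ} (f : (Fin N → J) → ℂ) : Prop :=
  ∀ (π : Equiv.Perm (Fin N)) (x : Fin N → J), f (x ∘ π) = f x

/-- Unnormalized symmetrization `Σ_π P_π ψ`. -/
def symmetrize {J : Type*} {N : ℕ} (ψ : (Fin N → J) → ℂ) : (Fin N → J) → ℂ :=
  fun x => ∑ π : Equiv.Perm (Fin N), ψ (x ∘ π)

/-- Normalized symmetrization `Sym(ψ)`. -/
def SymOf {J : Type*} [Fintype J] {N : ℕ} (ψ : (Fin N → J) → ℂ) : (Fin N → J) → ℂ :=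
  ((l2norm (symmetrize ψ) : ℂ))⁻¹ • symmetrize ψ

/-- Partial trace over the first `m` of `m + k` tensor factors. -/
def ptraceFirst {J : Type*} [Fintype J] [DecidableEq J] {m k : ℕ}
    (ρ : Matrix (Fin (m + k) → J) (Fin (m + k) → J) ℂ) :
    Matrix (Fin k → J) (Fin k → J) ℂ :=
  fun x y => ∑ a : Fin m → J, ρ (Fin.append a x) (Fin.append a y)

/-- Partial trace over the environment components of `N` system–environment pairs. -/
def ptraceE {A E : Type*} [Fintype A] [Fintype E] {N : ℕ}
    (ρ : Matrix (Fin N → A × E) (Fin N → A × E) ℂ) :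
    Matrix (Fin N → A) (Fin N → A) ℂ :=
  fun x y => ∑ e : Fin N → E, ρ (fun i => (x i, e i)) (fun i => (y i, e i))

/-- The set of `(N choose r)`-i.i.d. vectors along `θ`: vectors which are `θ` on
`N − r` of the positions (the permutations of `θ^{⊗(N−r)} ⊗ ψ_r`). -/
def powVecSet {J : Type*} (θ : J → ℂ) (N r : ℕ) : Set ((Fin N → J) → ℂ) :=
  {f | ∃ S : Finset (Fin N), S.card = N - r ∧
    ∃ ψ : ({i : Fin N // i ∉ S} → J) → ℂ,
      f = fun x => (∏ i ∈ S, θ (x i)) * ψ (fun j => x j.1)}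

/-- Almost power states along `θ`: `|θ⟩^{[⊗,N,r]} = Sym(ℋ^{⊗N}) ∩ span V(ℋ^{⊗N}, θ^{⊗N−r})`. -/
def almostPower {J : Type*} (θ : J → ℂ) (N r : ℕ) : Set ((Fin N → J) → ℂ) :=
  {f | IsSymVec f ∧ f ∈ Submodule.span ℂ (powVecSet θ N r)}

/-- `η ⊗ θ^{⊗(N−k)}`: the vector `η` on the first `k` slots and `θ` on the rest. -/
def etaTensor {J : Type*} {N k : ℕ} (h : k ≤ N) (η : (Fin k → J) → ℂ) (θ : J → ℂ) :
    (Fin N → J) → ℂ :=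
  fun x => η (fun i => x (Fin.castLE h i)) * ∏ i : Fin N, if (i : ℕ) < k then 1 else θ (x i)

/-- `η` lies in the `k`-fold tensor power of the orthogonal complement of `θ`:
the contraction of `η` with `⟨θ|` at any slot vanishes. -/
def InPerpPow {J : Type*} [Fintype J] [DecidableEq J] {k : ℕ} (θ : J → ℂ)
    (η : (Fin k → J) → ℂ) : Prop :=
  ∀ (j : Fin k) (z : Fin k → J), ∑ a : J, star (θ a) * η (Function.update z j a) = 0

/-- Binary Shannon entropy. -/
def binEnt (x : ℝ) : ℝ := -(x * Real.logb 2 x) - (1 - x) * Real.logb 2 (1 - x)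

/-- Product operator `σ₁ ⊗ ⋯ ⊗ σ_k` of a `k`-partite system. -/
def prodOp {k : ℕ} {ι : Fin k → Type*} [∀ i, Fintype (ι i)]
    (σs : ∀ i, Matrix (ι i) (ι i) ℂ) : Matrix (∀ i, ι i) (∀ i, ι i) ℂ :=
  fun x y => ∏ i, σs i (x i) (y i)

/-- Separability of a `k`-partite state: a finite convex combination of product states. -/
def IsSeparable {k : ℕ} {ι : Fin k → Type*} [∀ i, Fintype (ι i)]
    (ρ : Matrix (∀ i, ι i) (∀ i, ι i) ℂ) : Prop :=
  ∃ (m : ℕ) (p : Fin m → ℝ) (σs : Fin m → ∀ i, Matrix (ι i) (ι i) ℂ),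
    (∀ j, 0 ≤ p j) ∧ (∑ j, p j = 1) ∧ (∀ j i, IsState (σs j i)) ∧
    ρ = ∑ j, p j • prodOp (σs j)

/-- Relative entropy of entanglement `E_R(ρ) = inf {S(ρ‖ω) : ω separable}`. -/
def ERel {k : ℕ} {ι : Fin k → Type*} [∀ i, Fintype (ι i)] [∀ i, DecidableEq (ι i)]
    (ρ : Matrix (∀ i, ι i) (∀ i, ι i) ℂ) : ℝ :=
  sInf {x | ∃ ω, IsSeparable ω ∧ SuppLe ρ ω ∧ x = relEnt ρ ω}

/-- `ρ^{⊗n}` of a `k`-partite state, viewed as a `k`-partite state where the `i`-th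
party holds the `n` copies of its system. -/
def tpowMulti {k : ℕ} {d : Fin k → ℕ} (ρ : Matrix (∀ i, Fin (d i)) (∀ i, Fin (d i)) ℂ)
    (n : ℕ) : Matrix (∀ i, Fin n → Fin (d i)) (∀ i, Fin n → Fin (d i)) ℂ :=
  fun x y => ∏ t : Fin n, ρ (fun i => x i t) (fun i => y i t)

/-- `ρ^{⊗n}` of a bipartite state in the grouped bipartition `A^{⊗n} : B^{⊗n}`. -/
def tpowBi {A B : Type*} [Fintype A] [Fintype B]
    (ρ : Matrix (A × B) (A × B) ℂ) (n : ℕ) :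
    Matrix ((Fin n → A) × (Fin n → B)) ((Fin n → A) × (Fin n → B)) ℂ :=
  fun x y => ∏ i, ρ (x.1 i, x.2 i) (y.1 i, y.2 i)

/-- `k`-extendibility of a bipartite state. -/
def IsKExtendible {A B : Type*} [Fintype A] [Fintype B] (k : ℕ)
    (σ : Matrix (A × B) (A × B) ℂ) : Prop :=
  ∃ σ' : Matrix (A × (Fin k → B)) (A × (Fin k → B)) ℂ,
    IsState σ' ∧
    (∀ (π : Equiv.Perm (Fin k)) (p q : A × (Fin k → B)),
      σ' (p.1, p.2 ∘ π) (q.1, q.2 ∘ π) = σ' p q) ∧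
    (∀ p q : A × B, σ p q =
      ∑ f : {i : Fin k // (i : ℕ) ≠ 0} → B,
        σ' (p.1, fun i => if h : (i : ℕ) = 0 then p.2 else f ⟨i, h⟩)
           (q.1, fun i => if h : (i : ℕ) = 0 then q.2 else f ⟨i, h⟩))

set_option linter.unusedSectionVars false

open Matrix

lemma exists_eq_conjTranspose_mul_self {A : Matrix I I ℂ} (hA : A.PosSemidef) :
    ∃ C : Matrix I I ℂ, A = C.conjTranspose * C := by
  open scoped MatrixOrder Matrix.Norms.L2Operator in
  exact CStarAlgebra.nonneg_iff_eq_star_mul_self.mp hA.nonneg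

/-- The trace pairing of two positive semidefinite matrices is nonnegative. -/
lemma re_trace_mul_nonneg {A B : Matrix I I ℂ} (hA : A.PosSemidef) (hB : B.PosSemidef) :
    0 ≤ ((A * B).trace).re := by
  obtain ⟨C, rfl⟩ : ∃ C : Matrix I I ℂ, A = C.conjTranspose * C :=
    exists_eq_conjTranspose_mul_self hA
  rw [Matrix.mul_assoc, Matrix.trace_mul_comm]
  exact (Complex.nonneg_iff.mp (hB.mul_mul_conjTranspose_same C).trace_nonneg).1

lemma re_trace_mul_mono_right {A X Y : Matrix I I ℂ} (hA : A.PosSemidef)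
    (h : (Y - X).PosSemidef) : ((A * X).trace).re ≤ ((A * Y).trace).re := by
  have := re_trace_mul_nonneg hA h
  rw [Matrix.mul_sub, Matrix.trace_sub, Complex.sub_re] at this
  linarith

lemma tprod_mul {n m : ℕ} (A B : Matrix (Fin n → I) (Fin n → I) ℂ)
    (C D : Matrix (Fin m → I) (Fin m → I) ℂ) :
    tprod (A * B) (C * D) = tprod A C * tprod B D := by
  ext x y
  simp only [tprod, Matrix.mul_apply]
  rw [← (Fin.appendEquiv n m).sum_comp, Fintype.sum_prod_type, Finset.sum_mul_sum]
  refine Finset.sum_congr rfl fun a _ => Finset.sum_congr rfl fun b _ => ?_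
  simp [Fin.appendEquiv]
  ring

lemma tprod_conjTranspose {n m : ℕ} (A : Matrix (Fin n → I) (Fin n → I) ℂ)
    (B : Matrix (Fin m → I) (Fin m → I) ℂ) : (tprod A B)ᴴ = tprod Aᴴ Bᴴ := by
  ext x y
  simp [tprod, Matrix.conjTranspose_apply]

lemma tprod_diagonal {n m : ℕ} (p : (Fin n → I) → ℂ) (q : (Fin m → I) → ℂ) :
    tprod (Matrix.diagonal p) (Matrix.diagonal q) =
      Matrix.diagonal (fun x => p (fun i => x (Fin.castAdd m i)) *
        q (fun j => x (Fin.natAdd n j))) := by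
  ext x y
  by_cases h : x = y
  · subst h
    simp [tprod]
  · rw [Matrix.diagonal_apply_ne _ h]
    simp only [tprod, Matrix.diagonal_apply]
    split_ifs with h1 h2
    · refine absurd (funext fun i => ?_) h
      refine Fin.addCases (fun i => congrFun h1 i) (fun i => congrFun h2 i) i
    all_goals simp

lemma tprod_one {n m : ℕ} : tprod (1 : Matrix (Fin n → I) (Fin n → I) ℂ)
    (1 : Matrix (Fin m → I) (Fin m → I) ℂ) = 1 := by
  rw [← Matrix.diagonal_one, ← Matrix.diagonal_one, tprod_diagonal]
  simp

lemma tpow_add (ρ : Matrix I I ℂ) (n m : ℕ) :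
    tpow ρ (n + m) = tprod (tpow ρ n) (tpow ρ m) := by
  ext x y
  simp [tpow, tprod, Fin.prod_univ_add]

lemma tpow_mul (A B : Matrix I I ℂ) (n : ℕ) : tpow (A * B) n = tpow A n * tpow B n := by
  ext x y
  simp only [tpow, Matrix.mul_apply, ← Finset.prod_mul_distrib]
  rw [Finset.prod_univ_sum]
  simp

lemma tpow_conjTranspose (A : Matrix I I ℂ) (n : ℕ) : (tpow A n)ᴴ = tpow Aᴴ n := by
  ext x y
  simp [tpow, Matrix.conjTranspose_apply]

lemma tpow_one (n : ℕ) : tpow (1 : Matrix I I ℂ) n = 1 := by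
  ext x y
  by_cases h : x = y
  · subst h
    simp [tpow]
  · obtain ⟨i, hi⟩ := Function.ne_iff.mp h
    rw [Matrix.one_apply_ne h]
    exact Finset.prod_eq_zero (Finset.mem_univ i) (Matrix.one_apply_ne hi)

lemma trace_tpow (ρ : Matrix I I ℂ) (n : ℕ) : (tpow ρ n).trace = ρ.trace ^ n := by
  simp only [tpow, Matrix.trace, Matrix.diag]
  rw [← Fin.prod_const n, Finset.prod_univ_sum]
  simp

lemma tpow_isState {ρ : Matrix I I ℂ} (hρ : IsState ρ) (n : ℕ) : IsState (tpow ρ n) := by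
  refine ⟨?_, by rw [trace_tpow, hρ.2, one_pow]⟩
  obtain ⟨C, rfl⟩ : ∃ C : Matrix I I ℂ, ρ = C.conjTranspose * C :=
    exists_eq_conjTranspose_mul_self hρ.1
  rw [tpow_mul, ← tpow_conjTranspose]
  exact Matrix.posSemidef_conjTranspose_mul_self _

/-- Every support is contained in that of a tensor power of a positive definite matrix. -/
lemma suppLe_tpow {σ : Matrix I I ℂ} (hσ : σ.PosDef) (n : ℕ)
    (R : Matrix (Fin n → I) (Fin n → I) ℂ) : SuppLe R (tpow σ n) := by
  intro v hv
  have h : tpow σ⁻¹ n * tpow σ n = 1 := by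
    rw [← tpow_mul, Matrix.nonsing_inv_mul _ ((Matrix.isUnit_iff_isUnit_det σ).mp hσ.isUnit),
      tpow_one]
  have : v = 0 := by
    rw [← Matrix.one_mulVec v, ← h, ← Matrix.mulVec_mulVec, hv, Matrix.mulVec_zero]
  rw [this, Matrix.mulVec_zero]


/-- `V` and `q` diagonalize the positive semidefinite matrix `W`, and the diagonal of `R` in the
eigenbasis of `W` vanishes on the kernel of `W`. -/
structure EigenData (R W V : Matrix I I ℂ) (q : I → ℝ) : Prop where
  isometry : Vᴴ * V = 1
  spec : W = V * diagonal (fun y => (q y : ℂ)) * Vᴴ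
  nonneg : ∀ y, 0 ≤ q y
  supp : ∀ y, q y = 0 → (Vᴴ * R * V) y y = 0

/-- The moment `tr (R W ^ t)` computed from a diagonalization of `W`. -/
def moment (R V : Matrix I I ℂ) (q : I → ℝ) (t : ℝ) : ℂ :=
  ∑ y, (Vᴴ * R * V) y y * ((q y ^ t : ℝ) : ℂ)

lemma eigenData_eigenvectorUnitary {R W : Matrix I I ℂ} (hW : W.PosSemidef) (h : SuppLe R W) :
    EigenData R W hW.1.eigenvectorUnitary hW.1.eigenvalues := by
  have h1 : (hW.1.eigenvectorUnitary : Matrix I I ℂ)ᴴ * hW.1.eigenvectorUnitary = 1 :=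
    Unitary.coe_star_mul_self hW.1.eigenvectorUnitary
  have h2 : W = (hW.1.eigenvectorUnitary : Matrix I I ℂ) *
      diagonal (fun y => (hW.1.eigenvalues y : ℂ)) *
      (hW.1.eigenvectorUnitary : Matrix I I ℂ)ᴴ := hW.1.spectral_theorem
  refine ⟨h1, h2, hW.eigenvalues_nonneg, fun y hy => ?_⟩
  generalize (hW.1.eigenvectorUnitary : Matrix I I ℂ) = V at *
  have h3 : W * V = V * diagonal (fun y => (hW.1.eigenvalues y : ℂ)) := by
    conv_lhs => rw [h2]
    rw [Matrix.mul_assoc, h1, Matrix.mul_one]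
  have h4 : R *ᵥ (fun j => V j y) = 0 := by
    apply h
    ext j
    have : (W * V) j y = 0 := by rw [h3]; simp [hy]
    simpa [Matrix.mul_apply, Matrix.mulVec, dotProduct] using this
  rw [Matrix.mul_assoc, Matrix.mul_apply]
  refine Finset.sum_eq_zero fun j _ => ?_
  have : (R * V) j y = 0 := congrFun h4 j
  rw [this, mul_zero]

lemma trace_mul_conj_diagonal (R V : Matrix I I ℂ) (g : I → ℂ) :
    (R * (V * diagonal g * Vᴴ)).trace = ∑ y, (Vᴴ * R * V) y y * g y := by
  rw [← Matrix.mul_assoc, Matrix.trace_mul_comm, ← Matrix.mul_assoc, ← Matrix.mul_assoc]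
  simp [Matrix.trace, Matrix.mul_diagonal]

lemma re_trace_mul_conj_diagonal (R V : Matrix I I ℂ) (g : I → ℝ) :
    ((R * (V * diagonal (fun y => (g y : ℂ)) * Vᴴ)).trace).re =
      ∑ y, ((Vᴴ * R * V) y y).re * g y := by
  rw [trace_mul_conj_diagonal, Complex.re_sum]
  simp

lemma diag_conj_nonneg {R : Matrix I I ℂ} (hR : R.PosSemidef) (V : Matrix I I ℂ) (y : I) :
    0 ≤ (Vᴴ * R * V) y y :=
  (hR.conjTranspose_mul_mul_same V).diag_nonneg

lemma EigenData.isometry' {R W V : Matrix I I ℂ} {q : I → ℝ} (h : EigenData R W V q) :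
    V * Vᴴ = 1 := _root_.mul_eq_one_comm.mp h.isometry

lemma EigenData.sum_diag {R W V : Matrix I I ℂ} {q : I → ℝ} (h : EigenData R W V q)
    (hR : IsState R) : ∑ y, ((Vᴴ * R * V) y y).re = 1 := by
  have := re_trace_mul_conj_diagonal R V (fun _ => 1)
  simp only [Complex.ofReal_one, Matrix.diagonal_one, h.isometry', hR.2, mul_one,
    Complex.one_re] at this
  exact this.symm

lemma norm_moment {R : Matrix I I ℂ} (hR : R.PosSemidef) (V : Matrix I I ℂ) {q : I → ℝ}
    (hq : ∀ y, 0 ≤ q y) (t : ℝ) :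
    ‖moment R V q t‖ = ∑ y, ((Vᴴ * R * V) y y).re * q y ^ t := by
  have h0 : moment R V q t = ((∑ y, ((Vᴴ * R * V) y y).re * q y ^ t : ℝ) : ℂ) := by
    rw [moment, Complex.ofReal_sum]
    refine Finset.sum_congr rfl fun y _ => ?_
    obtain ⟨-, hi⟩ := Complex.nonneg_iff.mp (diag_conj_nonneg hR V y)
    apply Complex.ext <;> simp [← hi]
  rw [h0, Complex.norm_real, Real.norm_of_nonneg]
  exact Finset.sum_nonneg fun y _ => mul_nonneg
    (Complex.nonneg_iff.mp (diag_conj_nonneg hR V y)).1 (Real.rpow_nonneg (hq y) t)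

/-- Markov's inequality for the eigenvalue distribution: the weight of the eigenvalues `x` with
`b < x ^ t` is at most `b⁻¹ tr (R W ^ t)`. -/
lemma EigenData.sum_indicator_le {R W V : Matrix I I ℂ} {q : I → ℝ} (h : EigenData R W V q)
    (hR : R.PosSemidef) (P : ℝ → Prop) [DecidablePred P] {t b : ℝ} (hb : 0 < b)
    (hP : ∀ x, 0 < x → P x → b ≤ x ^ t) :
    ∑ y, ((Vᴴ * R * V) y y).re * (if P (q y) then 1 else 0) ≤ b⁻¹ * ‖moment R V q t‖ := by
  rw [norm_moment hR V h.nonneg, Finset.mul_sum]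
  refine Finset.sum_le_sum fun y _ => ?_
  have hD := (Complex.nonneg_iff.mp (diag_conj_nonneg hR V y)).1
  rcases (h.nonneg y).eq_or_lt with h0 | h0
  · simp [h.supp y h0.symm]
  · rw [mul_left_comm]
    refine mul_le_mul_of_nonneg_left ?_ hD
    split_ifs with hy
    · rw [inv_mul_eq_div, le_div_iff₀ hb, one_mul]
      exact hP _ h0 hy
    · positivity

/-- Exponential moments beat any exponent above the logarithmic mean. -/
lemma EigenData.exists_moment_lt_one {R W V : Matrix I I ℂ} {q : I → ℝ} (h : EigenData R W V q)
    (hR : IsState R) (e a : ℝ)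
    (ha : e * ∑ y, ((Vᴴ * R * V) y y).re * Real.logb 2 (q y) < a) :
    ∃ s : ℝ, 0 < s ∧ ‖moment R V q (e * s)‖ * 2 ^ (-(a * s)) < 1 := by
  set D : I → ℝ := fun y => ((Vᴴ * R * V) y y).re with hD
  set f : ℝ → ℝ := fun s => ∑ y, D y * Real.exp (s * (e * Real.log (q y) - a * Real.log 2))
  have hf0 : f 0 = 1 := by simpa [f] using h.sum_diag hR
  have hder : HasDerivAt f (∑ y, D y * (e * Real.log (q y) - a * Real.log 2)) 0 := by
    refine HasDerivAt.fun_sum fun y _ => HasDerivAt.const_mul _ ?_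
    simpa using ((hasDerivAt_id (0 : ℝ)).mul_const (e * Real.log (q y) - a * Real.log 2)).exp
  have hneg : ∑ y, D y * (e * Real.log (q y) - a * Real.log 2) < 0 := by
    have h2 : 0 < Real.log 2 := Real.log_pos one_lt_two
    have : ∑ y, D y * (e * Real.log (q y) - a * Real.log 2) =
        Real.log 2 * (e * ∑ y, D y * Real.logb 2 (q y)) - a * Real.log 2 * ∑ y, D y := by
      simp only [Finset.mul_sum, ← Finset.sum_sub_distrib]
      refine Finset.sum_congr rfl fun y _ => ?_
      rw [Real.logb]
      field_simp
    rw [this, h.sum_diag hR]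
    nlinarith
  obtain ⟨s, hs0, hs⟩ : ∃ s : ℝ, 0 < s ∧ f s < 1 := by
    have := (hasDerivAt_iff_tendsto_slope_zero.mp hder).mono_left
      (nhdsWithin_mono (0 : ℝ) (s := Set.Ioi 0) fun x (hx : 0 < x) => hx.ne')
    obtain ⟨s, hs, hs0⟩ := ((this.eventually_lt_const hneg).and self_mem_nhdsWithin).exists
    refine ⟨s, hs0, ?_⟩
    rw [zero_add, hf0, smul_eq_mul] at hs
    by_contra! hge
    exact absurd hs (not_lt.mpr (mul_nonneg (inv_pos.mpr hs0).le (sub_nonneg.mpr hge)))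
  refine ⟨s, hs0, lt_of_eq_of_lt ?_ hs⟩
  rw [norm_moment hR.1 V h.nonneg, Finset.sum_mul]
  refine Finset.sum_congr rfl fun y _ => ?_
  rcases (h.nonneg y).eq_or_lt with h0 | h0
  · simp [hD, h.supp y h0.symm]
  · rw [Real.rpow_def_of_pos h0, Real.rpow_def_of_pos two_pos, mul_assoc, ← Real.exp_add]
    congr 2
    ring

lemma re_trace_mul_mlog {R W : Matrix I I ℂ} (hW : W.PosSemidef) (h : SuppLe R W) :
    ((R * mlog W).trace).re = ∑ y, (((hW.1.eigenvectorUnitary : Matrix I I ℂ)ᴴ * R *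
      hW.1.eigenvectorUnitary) y y).re * Real.logb 2 (hW.1.eigenvalues y) := by
  have hE := eigenData_eigenvectorUnitary hW h
  rw [mlog, fcal, dif_pos hW.1, Matrix.star_eq_conjTranspose, re_trace_mul_conj_diagonal]
  refine Finset.sum_congr rfl fun y _ => ?_
  split_ifs with h0
  · rfl
  · rw [hE.supp y (le_antisymm (not_lt.mp h0) (hE.nonneg y))]
    simp

lemma exists_eigenData {R W : Matrix I I ℂ} (hW : W.PosSemidef) (h : SuppLe R W) :
    ∃ V q, EigenData R W V q ∧ ((R * mlog W).trace).re =
      ∑ y, ((Vᴴ * R * V) y y).re * Real.logb 2 (q y) :=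
  ⟨_, _, eigenData_eigenvectorUnitary hW h, re_trace_mul_mlog hW h⟩

/-- The operator with eigenvalues `g` along the columns of `V`. -/
def conjDiag (V : Matrix I I ℂ) (g : I → ℝ) : Matrix I I ℂ :=
  V * diagonal (fun y => (g y : ℂ)) * Vᴴ

lemma conjDiag_posSemidef (V : Matrix I I ℂ) {g : I → ℝ} (hg : ∀ y, 0 ≤ g y) :
    (conjDiag V g).PosSemidef :=
  (PosSemidef.diagonal fun y => Complex.zero_le_real.mpr (hg y)).mul_mul_conjTranspose_same V

lemma conjDiag_mul {V : Matrix I I ℂ} (hV : Vᴴ * V = 1) (g g' : I → ℝ) :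
    conjDiag V g * conjDiag V g' = conjDiag V (fun y => g y * g' y) := by
  calc conjDiag V g * conjDiag V g'
      = V * (diagonal (fun y => (g y : ℂ)) * (Vᴴ * V) * diagonal (fun y => (g' y : ℂ))) * Vᴴ := by
        simp only [conjDiag, Matrix.mul_assoc]
    _ = conjDiag V (fun y => g y * g' y) := by
        rw [hV, Matrix.mul_one, diagonal_mul_diagonal]
        simp [conjDiag]

lemma conjDiag_add (V : Matrix I I ℂ) (g g' : I → ℝ) :
    conjDiag V g + conjDiag V g' = conjDiag V (fun y => g y + g' y) := by
  rw [conjDiag, conjDiag, ← Matrix.add_mul, ← Matrix.mul_add, diagonal_add]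
  simp [conjDiag]

lemma conjDiag_smul (V : Matrix I I ℂ) (c : ℝ) (g : I → ℝ) :
    (c : ℂ) • conjDiag V g = conjDiag V (fun y => c * g y) := by
  rw [conjDiag, ← Matrix.smul_mul, ← Matrix.mul_smul, ← diagonal_smul]
  simp only [conjDiag, Complex.ofReal_mul]
  rfl

lemma conjDiag_one {V : Matrix I I ℂ} (hV : V * Vᴴ = 1) : conjDiag V (fun _ => 1) = 1 := by
  simp [conjDiag, hV]

/-- A test `A` accepts `R` with probability controlled by its acceptance probability on `W`, up to
the weight of the eigenvalues of `R` above `α` and of the eigenvalues of `W` below `β`. -/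
lemma re_trace_test_le {A R W U V : Matrix I I ℂ} {p q : I → ℝ} (hA : A.PosSemidef)
    (hA' : (1 - A).PosSemidef) (hR : R.PosSemidef) (hU : EigenData R R U p)
    (hV : EigenData R W V q) {α β : ℝ} (hα : 0 < α) (hβ : 0 < β) :
    ((A * R).trace).re ≤ 2 * (α / β * ((A * W).trace).re) +
      2 * ∑ x, ((Uᴴ * R * U) x x).re * (if α < p x then 1 else 0) +
      2 * ∑ y, ((Vᴴ * R * V) y y).re * (if q y < β then 1 else 0) := by
  set T := conjDiag V (fun y => if q y < β then 0 else 1) with hT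
  set T' := conjDiag V (fun y => if q y < β then 1 else 0) with hT'
  set Q := conjDiag U (fun x => if α < p x then 1 else 0) with hQ
  have hTp : T.PosSemidef := conjDiag_posSemidef V fun y => by split_ifs <;> simp
  have hTp' : T'.PosSemidef := conjDiag_posSemidef V fun y => by split_ifs <;> simp
  have hTT : T * T = T := by
    rw [hT, conjDiag_mul hV.isometry]; congr 1; ext y; split_ifs <;> simp
  have hTT' : T' * T' = T' := by
    rw [hT', conjDiag_mul hV.isometry]; congr 1; ext y; split_ifs <;> simp
  have hsum : T + T' = 1 := by
    rw [hT, hT', conjDiag_add, ← conjDiag_one hV.isometry']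
    congr 1; ext y; split_ifs <;> simp
  have hsandwich : ∀ {X S : Matrix I I ℂ}, X.PosSemidef → S.IsHermitian →
      (S * X * S).PosSemidef := fun {X S} hX hS => by
    simpa only [hS.eq] using hX.mul_mul_conjTranspose_same S
  have hpinch : ((A * R).trace).re ≤
      2 * ((T * A * T * R).trace).re + 2 * ((T' * A * T' * R).trace).re := by
    have h := re_trace_mul_nonneg (hsandwich hA (hTp.1.sub hTp'.1)) hR
    have h' : (T - T') * A * (T - T') * R + A * R =
        (T * A * T * R + T * A * T * R) + (T' * A * T' * R + T' * A * T' * R) := by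
      have : A * R = (T + T') * A * (T + T') * R := by
        rw [hsum, Matrix.one_mul, Matrix.mul_one]
      rw [this]
      noncomm_ring
    have h'' := congrArg (fun X : Matrix I I ℂ => X.trace.re) h'
    simp only [Matrix.trace_add, Complex.add_re] at h''
    linarith
  have hlow : ((T' * A * T' * R).trace).re ≤
      ∑ y, ((Vᴴ * R * V) y y).re * (if q y < β then 1 else 0) := by
    rw [← re_trace_mul_conj_diagonal, Matrix.trace_mul_comm]
    refine re_trace_mul_mono_right hR ?_
    have := hsandwich hA' hTp'.1
    rwa [Matrix.mul_sub, Matrix.sub_mul, Matrix.mul_one, hTT'] at this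
  have hTA : (T * A * T).PosSemidef := hsandwich hA hTp.1
  have hRspec : R = conjDiag U p := hU.spec
  have hRQ : R * Q = conjDiag U (fun x => p x * (if α < p x then 1 else 0)) := by
    conv_lhs => rw [hRspec]
    rw [hQ, conjDiag_mul hU.isometry]
  have hcut : ((T * A * T * R).trace).re ≤
      α * ((T * A * T).trace).re + ((T * A * T * (R * Q)).trace).re := by
    have h : ((α : ℂ) • (1 : Matrix I I ℂ) + R * Q - R).PosSemidef := by
      have : (α : ℂ) • (1 : Matrix I I ℂ) + R * Q - R =
          conjDiag U (fun x => α * 1 + p x * (if α < p x then 1 else 0) + -1 * p x) := by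
        rw [← conjDiag_add, ← conjDiag_add, ← conjDiag_smul, ← conjDiag_smul,
          conjDiag_one hU.isometry', hRQ, ← hRspec]
        simp [sub_eq_add_neg]
      rw [this]
      refine conjDiag_posSemidef U fun x => ?_
      split_ifs with hx <;> linarith
    have := re_trace_mul_mono_right hTA h
    rw [Matrix.mul_add, Matrix.mul_smul, Matrix.mul_one, Matrix.trace_add, Matrix.trace_smul,
      smul_eq_mul, Complex.add_re, Complex.re_ofReal_mul] at this
    exact this
  have hhigh : ((T * A * T * (R * Q)).trace).re ≤
      ∑ x, ((Uᴴ * R * U) x x).re * (if α < p x then 1 else 0) := by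
    rw [← re_trace_mul_conj_diagonal, Matrix.trace_mul_comm]
    change _ ≤ ((R * Q).trace).re
    have hRQp : (R * Q).PosSemidef := by
      rw [hRQ]
      exact conjDiag_posSemidef U fun x => mul_nonneg (hU.nonneg x) (by split_ifs <;> simp)
    have h : (1 - T * A * T).PosSemidef := by
      have := (hsandwich hA' hTp.1).add hTp'
      rw [Matrix.mul_sub, Matrix.sub_mul, Matrix.mul_one, hTT] at this
      rwa [show (1 : Matrix I I ℂ) - T * A * T = T - T * A * T + T' by rw [← hsum]; abel]
    simpa using re_trace_mul_mono_right hRQp h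
  have hmid : ((T * A * T).trace).re ≤ β⁻¹ * ((A * W).trace).re := by
    have h1 : (T * A * T).trace = (A * T).trace := by
      rw [Matrix.mul_assoc, Matrix.trace_mul_comm, Matrix.mul_assoc, hTT]
    have h : (W - (β : ℂ) • T).PosSemidef := by
      have : W - (β : ℂ) • T =
          conjDiag V (fun y => q y + -β * (if q y < β then 0 else 1)) := by
        rw [← conjDiag_add, ← conjDiag_smul, ← hT, show conjDiag V (fun y => q y) = W from
          hV.spec.symm]
        simp [sub_eq_add_neg]
      rw [this]
      refine conjDiag_posSemidef V fun y => ?_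
      have := hV.nonneg y
      split_ifs with hy <;> linarith
    have := re_trace_mul_mono_right hA h
    rw [Matrix.mul_smul, Matrix.trace_smul, smul_eq_mul, Complex.re_ofReal_mul] at this
    rw [h1, inv_mul_eq_div, le_div_iff₀ hβ]
    linarith
  have : α * ((T * A * T).trace).re ≤ α / β * ((A * W).trace).re :=
    (mul_le_mul_of_nonneg_left hmid hα.le).trans_eq (by ring)
  linarith

section Blocks

variable {n m : ℕ}

lemma EigenData.tprod {R W V : Matrix (Fin n → I) (Fin n → I) ℂ} {q : (Fin n → I) → ℝ}
    {R' W' V' : Matrix (Fin m → I) (Fin m → I) ℂ} {q' : (Fin m → I) → ℝ}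
    (h : EigenData R W V q) (h' : EigenData R' W' V' q') :
    EigenData (tprod R R') (tprod W W') (tprod V V')
      (fun x => q (fun i => x (Fin.castAdd m i)) * q' (fun j => x (Fin.natAdd n j))) where
  isometry := by rw [tprod_conjTranspose, ← tprod_mul, h.isometry, h'.isometry, tprod_one]
  spec := by
    rw [h.spec, h'.spec, tprod_mul, tprod_mul, tprod_diagonal, tprod_conjTranspose]
    simp
  nonneg x := mul_nonneg (h.nonneg _) (h'.nonneg _)
  supp x hx := by
    rw [tprod_conjTranspose, ← tprod_mul, ← tprod_mul, GQSL.tprod]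
    rcases mul_eq_zero.mp hx with hx | hx
    · rw [h.supp _ hx, zero_mul]
    · rw [h'.supp _ hx, mul_zero]

lemma moment_tprod {R V : Matrix (Fin n → I) (Fin n → I) ℂ} {q : (Fin n → I) → ℝ}
    {R' V' : Matrix (Fin m → I) (Fin m → I) ℂ} {q' : (Fin m → I) → ℝ}
    (hq : ∀ y, 0 ≤ q y) (hq' : ∀ y, 0 ≤ q' y) (t : ℝ) :
    moment (tprod R R') (tprod V V')
      (fun x => q (fun i => x (Fin.castAdd m i)) * q' (fun j => x (Fin.natAdd n j))) t =
      moment R V q t * moment R' V' q' t := by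
  rw [moment, tprod_conjTranspose, ← tprod_mul, ← tprod_mul, ← (Fin.appendEquiv n m).sum_comp,
    Fintype.sum_prod_type, moment, moment, Finset.sum_mul_sum]
  refine Finset.sum_congr rfl fun a _ => Finset.sum_congr rfl fun b _ => ?_
  simp only [tprod, Fin.appendEquiv_apply, Fin.append_left, Fin.append_right]
  rw [Real.mul_rpow (hq _) (hq' _), Complex.ofReal_mul]
  ring

/-- The `k`-fold tensor power of an operator on `n` copies, as an operator on `n * k` copies. -/
def blockPow (W : Matrix (Fin n → I) (Fin n → I) ℂ) :
    ∀ k : ℕ, Matrix (Fin (n * k) → I) (Fin (n * k) → I) ℂ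
  | 0 => 1
  | k + 1 => tprod (blockPow W k) W

lemma tpow_zero (ρ : Matrix I I ℂ) : tpow ρ 0 = 1 := by
  ext x y
  rw [Subsingleton.elim x y]
  simp [tpow]

lemma blockPow_tpow (ρ : Matrix I I ℂ) (k : ℕ) : blockPow (tpow ρ n) k = tpow ρ (n * k) := by
  induction k with
  | zero => exact (tpow_zero ρ).symm
  | succ k ih => rw [blockPow, ih]; exact (tpow_add ρ (n * k) n).symm

lemma EigenData.blockPow {R W V : Matrix (Fin n → I) (Fin n → I) ℂ} {q : (Fin n → I) → ℝ}
    (h : EigenData R W V q) (k : ℕ) :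
    ∃ q' : (Fin (n * k) → I) → ℝ,
      EigenData (blockPow R k) (blockPow W k) (blockPow V k) q' ∧
      ∀ t, moment (GQSL.blockPow R k) (GQSL.blockPow V k) q' t = moment R V q t ^ k := by
  induction k with
  | zero =>
    refine ⟨fun _ => 1, ⟨?_, ?_, fun _ => zero_le_one, fun _ hy => absurd hy one_ne_zero⟩,
      fun t => ?_⟩
    · simp [GQSL.blockPow]
    · simp [GQSL.blockPow]
    · simp [GQSL.blockPow, moment]
  | succ k ih =>
    obtain ⟨q', hq', hm⟩ := ih
    refine ⟨_, hq'.tprod h, fun t => ?_⟩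
    rw [pow_succ, ← hm t]
    exact moment_tprod hq'.nonneg h.nonneg t

end Blocks

/-- If the relative entropy of `ρ^{⊗n}` with respect to `ω` is below `x`, every test accepts
`ρ^{⊗(nk+r)}` with probability exponentially smaller in `k` than `2 ^ (x k)` times its acceptance
probability on `ω^{⊗k} ⊗ τ`, up to an exponentially small error. -/
lemma exists_block_bound {ρ : Matrix I I ℂ} (hρ : IsState ρ) {n : ℕ}
    {ω : Matrix (Fin n → I) (Fin n → I) ℂ} (hω : ω.PosSemidef) (hsupp : SuppLe (tpow ρ n) ω)
    {x : ℝ} (hx : relEnt (tpow ρ n) ω < x) :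
    ∃ c : ℝ, 0 ≤ c ∧ c < 1 ∧ ∀ {r : ℕ} {τ : Matrix (Fin r → I) (Fin r → I) ℂ}, τ.PosSemidef →
      SuppLe (tpow ρ r) τ → ∃ K : ℝ, 0 ≤ K ∧
        ∀ (k : ℕ) {A : Matrix (Fin (n * k + r) → I) (Fin (n * k + r) → I) ℂ},
          A.PosSemidef → (1 - A).PosSemidef →
          ((A * tpow ρ (n * k + r)).trace).re ≤
            (K + 2 * (2 ^ (x * k) * ((A * tprod (blockPow ω k) τ).trace).re)) * c ^ k := by
  have hS := tpow_isState hρ n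
  have hself : ∀ {J : Type _} [Fintype J] [DecidableEq J] (R : Matrix J J ℂ), SuppLe R R :=
    fun R v hv => hv
  obtain ⟨U, p, hU, hLU⟩ := exists_eigenData hS.1 (hself (tpow ρ n))
  obtain ⟨V, q, hV, hLV⟩ := exists_eigenData hω hsupp
  rw [relEnt, Matrix.mul_sub, Matrix.trace_sub, Complex.sub_re, hLU, hLV] at hx
  set Lρ := ∑ y, ((Uᴴ * tpow ρ n * U) y y).re * Real.logb 2 (p y)
  set Lω := ∑ y, ((Vᴴ * tpow ρ n * V) y y).re * Real.logb 2 (q y)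
  obtain ⟨δ, hδ, hxδ⟩ : ∃ δ : ℝ, 0 < δ ∧ Lρ - Lω + 3 * δ = x :=
    ⟨(x - (Lρ - Lω)) / 3, by linarith, by ring⟩
  obtain ⟨s₁, hs₁, hc₁⟩ := hU.exists_moment_lt_one hS 1 (Lρ + δ) (by linarith)
  obtain ⟨s₂, hs₂, hc₂⟩ := hV.exists_moment_lt_one hS (-1) (-Lω + δ) (by linarith)
  set c₁ := ‖moment (tpow ρ n) U p (1 * s₁)‖ * 2 ^ (-((Lρ + δ) * s₁)) with hc₁'
  set c₂ := ‖moment (tpow ρ n) V q (-1 * s₂)‖ * 2 ^ (-((-Lω + δ) * s₂)) with hc₂'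
  have hc₁0 : 0 ≤ c₁ := mul_nonneg (norm_nonneg _) (Real.rpow_nonneg two_pos.le _)
  have hc₂0 : 0 ≤ c₂ := mul_nonneg (norm_nonneg _) (Real.rpow_nonneg two_pos.le _)
  have hc₃ : (2 : ℝ) ^ (-δ) < 1 := Real.rpow_lt_one_of_one_lt_of_neg one_lt_two (by linarith)
  refine ⟨max (2 ^ (-δ)) (max c₁ c₂), le_max_of_le_right (le_max_of_le_left hc₁0),
    max_lt hc₃ (max_lt hc₁ hc₂), ?_⟩
  set c := max ((2 : ℝ) ^ (-δ)) (max c₁ c₂)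
  intro r τ hτ hτsupp
  have hSr := tpow_isState hρ r
  obtain ⟨Ur, pr, hUr, -⟩ := exists_eigenData hSr.1 (hself (tpow ρ r))
  obtain ⟨Vr, qr, hVr, -⟩ := exists_eigenData hτ hτsupp
  refine ⟨2 * ‖moment (tpow ρ r) Ur pr (1 * s₁)‖ + 2 * ‖moment (tpow ρ r) Vr qr (-1 * s₂)‖,
    by positivity, fun k A hA hA' => ?_⟩
  obtain ⟨pk, hUk, hmU⟩ := hU.blockPow k
  obtain ⟨qk, hVk, hmV⟩ := hV.blockPow k
  have hUN := hUk.tprod hUr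
  have hVN := hVk.tprod hVr
  have hmUN := moment_tprod (R := blockPow (tpow ρ n) k) (V := blockPow U k) (R' := tpow ρ r)
    (V' := Ur) hUk.nonneg hUr.nonneg (1 * s₁)
  have hmVN := moment_tprod (R := blockPow (tpow ρ n) k) (V := blockPow V k) (R' := tpow ρ r)
    (V' := Vr) hVk.nonneg hVr.nonneg (-1 * s₂)
  rw [hmU] at hmUN
  rw [hmV] at hmVN
  rw [blockPow_tpow, ← tpow_add] at hUN hVN hmUN hmVN
  have hSN := tpow_isState hρ (n * k + r)
  have hα : (0 : ℝ) < 2 ^ ((Lρ + δ) * k) := by positivity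
  have hβ : (0 : ℝ) < 2 ^ (-((-Lω + δ) * k)) := by positivity
  have hmain := re_trace_test_le hA hA' hSN.1 hUN hVN hα hβ
  have h₁ := hUN.sum_indicator_le hSN.1 (fun z => (2 : ℝ) ^ ((Lρ + δ) * k) < z)
    (t := 1 * s₁) (Real.rpow_pos_of_pos hα (1 * s₁)) fun z _ hz' =>
      Real.rpow_le_rpow hα.le hz'.le (by linarith)
  have h₂ := hVN.sum_indicator_le hSN.1 (fun z => z < (2 : ℝ) ^ (-((-Lω + δ) * k)))
    (t := -1 * s₂) (Real.rpow_pos_of_pos hβ (-1 * s₂)) fun z hz hz' =>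
      Real.rpow_le_rpow_of_nonpos hz hz'.le (by linarith)
  rw [hmUN, norm_mul, norm_pow, ← mul_assoc] at h₁
  rw [hmVN, norm_mul, norm_pow, ← mul_assoc] at h₂
  have hp₁ : ((2 ^ ((Lρ + δ) * k)) ^ (1 * s₁) : ℝ)⁻¹ * ‖moment (tpow ρ n) U p (1 * s₁)‖ ^ k =
      c₁ ^ k := by
    rw [hc₁', mul_pow, mul_comm, ← Real.rpow_mul two_pos.le, ← Real.rpow_neg two_pos.le,
      ← Real.rpow_mul_natCast two_pos.le]
    congr 2
    ring
  have hp₂ : ((2 ^ (-((-Lω + δ) * k))) ^ (-1 * s₂) : ℝ)⁻¹ *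
      ‖moment (tpow ρ n) V q (-1 * s₂)‖ ^ k = c₂ ^ k := by
    rw [hc₂', mul_pow, mul_comm, ← Real.rpow_mul two_pos.le, ← Real.rpow_neg two_pos.le,
      ← Real.rpow_mul_natCast two_pos.le]
    congr 2
    ring
  have hp₃ : (2 : ℝ) ^ ((Lρ + δ) * k) / 2 ^ (-((-Lω + δ) * k)) =
      2 ^ (x * k) * (2 ^ (-δ)) ^ k := by
    rw [← Real.rpow_sub two_pos, ← Real.rpow_mul_natCast two_pos.le, ← Real.rpow_add two_pos,
      ← hxδ]
    congr 1
    ring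
  have hle₁ : c₁ ^ k ≤ c ^ k := pow_le_pow_left₀ hc₁0 (by simp [c]) k
  have hle₂ : c₂ ^ k ≤ c ^ k := pow_le_pow_left₀ hc₂0 (by simp [c]) k
  have hle₃ : ((2 : ℝ) ^ (-δ)) ^ k ≤ c ^ k := pow_le_pow_left₀ (by positivity) (by simp [c]) k
  rw [hp₁] at h₁
  rw [hp₂] at h₂
  rw [hp₃] at hmain
  have hW : 0 ≤ ((A * tprod (blockPow ω k) τ).trace).re := by
    refine re_trace_mul_nonneg hA ?_
    rw [hVN.spec]
    exact conjDiag_posSemidef _ hVN.nonneg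
  have e₁ := mul_le_mul_of_nonneg_right hle₁ (norm_nonneg (moment (tpow ρ r) Ur pr (1 * s₁)))
  have e₂ := mul_le_mul_of_nonneg_right hle₂ (norm_nonneg (moment (tpow ρ r) Vr qr (-1 * s₂)))
  have e₃ := mul_le_mul_of_nonneg_left hle₃
    (mul_nonneg (Real.rpow_nonneg two_pos.le (x * k)) hW)
  linarith

/-- A rate bound on an acceptance probability `z`; it also holds for `z = 0`. -/
lemma le_rpow_of_rate {z E ε : ℝ} {N : ℕ} (hz : 0 ≤ z) (hN : 0 < N)
    (h : E ≤ -Real.logb 2 z / N - ε) : z ≤ 2 ^ (-(N * (E + ε))) := by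
  rcases hz.eq_or_lt with rfl | hz
  · positivity
  · rw [← Real.logb_le_iff_le_rpow one_lt_two hz]
    have hN' : (0 : ℝ) < N := Nat.cast_pos.mpr hN
    have : E + ε ≤ -Real.logb 2 z / N := by linarith
    rw [le_div_iff₀ hN'] at this
    linarith

/-- **Generalized quantum Stein's Lemma, strong converse.**  For a family `{M n}`
satisfying properties 1–5 and a state `ρ` with `E = E_M^∞(ρ)`, if `ε > 0` and the POVM
elements `0 ≤ A n ≤ 1` satisfy `−(1/n) log₂ tr(A n ω) − ε ≥ E` for every `n ≥ 1` and
every `ω ∈ M n`, then `tr((1 − A n) ρ^{⊗n}) → 1`. -/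
theorem generalized_stein_strong_converse {d : ℕ} (σ : Matrix (Fin d) (Fin d) ℂ)
    (M : ∀ n : ℕ, Set (Matrix (Fin n → Fin d) (Fin n → Fin d) ℂ))
    (hM : GoodFamily σ M)
    (ρ : Matrix (Fin d) (Fin d) ℂ) (hρ : IsState ρ)
    (E : ℝ)
    (hE : Filter.Tendsto (fun n : ℕ => EMset (M n) (tpow ρ n) / n) Filter.atTop (nhds E))
    (ε : ℝ) (hε : 0 < ε)
    (A : ∀ n : ℕ, Matrix (Fin n → Fin d) (Fin n → Fin d) ℂ)
    (hA : ∀ n, (A n).PosSemidef ∧ (1 - A n).PosSemidef)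
    (hrate : ∀ n : ℕ, 0 < n → ∀ ω ∈ M n,
      E ≤ -Real.logb 2 (((A n * ω).trace).re) / n - ε) :
    Filter.Tendsto (fun n : ℕ => (((1 - A n) * tpow ρ n).trace).re)
      Filter.atTop (nhds 1) := by
  have hevE : ∀ᶠ n : ℕ in atTop, EMset (M n) (tpow ρ n) / n < E + ε :=
    hE.eventually_lt_const (by linarith)
  obtain ⟨n, hnE, hn⟩ := (hevE.and (eventually_gt_atTop 0)).exists
  have hn' : (0 : ℝ) < n := Nat.cast_pos.mpr hn
  rw [div_lt_iff₀ hn', mul_comm] at hnE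
  have hne : {x | ∃ ω ∈ M n, SuppLe (tpow ρ n) ω ∧ x = relEnt (tpow ρ n) ω}.Nonempty :=
    ⟨_, tpow σ n, hM.sigma_mem n, suppLe_tpow hM.sigma_posdef n _, rfl⟩
  obtain ⟨x, ⟨ω, hω, hsupp, rfl⟩, hlt⟩ := exists_lt_of_csInf_lt hne hnE
  obtain ⟨c, hc0, hc1, hc⟩ := exists_block_bound hρ (hM.states n ω hω).1 hsupp hlt
  choose K hK0 hK using fun r => hc (hM.states r _ (hM.sigma_mem r)).1
    (suppLe_tpow hM.sigma_posdef r (tpow ρ r))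
  have hmem : ∀ k, blockPow ω k ∈ M (n * k) := by
    intro k
    induction k with
    | zero =>
      have h := hM.sigma_mem 0
      rw [tpow_zero] at h
      exact h
    | succ k ih => exact hM.tprod_mem (n * k) n _ ih _ hω
  set F : ℕ → ℝ := fun r => K r + 2 * 2 ^ (-(r * (E + ε))) with hF
  have hF0 : ∀ r, 0 ≤ F r := fun r => add_nonneg (hK0 r) (by positivity)
  have hbound : ∀ N, n ≤ N →
      ((A N * tpow ρ N).trace).re ≤ (∑ r ∈ Finset.range n, F r) * c ^ (N / n) := by
    intro N hN
    have key : ∀ k r, n * k + r = N → ((A N * tpow ρ N).trace).re ≤ F r * c ^ k := by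
      rintro k r rfl
      refine (hK r k (hA _).1 (hA _).2).trans
        (mul_le_mul_of_nonneg_right ?_ (pow_nonneg hc0 k))
      have hW := hM.tprod_mem _ _ _ (hmem k) _ (hM.sigma_mem r)
      have hN0 : 0 < n * k + r := hn.trans_le hN
      have hacc := le_rpow_of_rate (re_trace_mul_nonneg (hA _).1 (hM.states _ _ hW).1) hN0
        (hrate _ hN0 _ hW)
      have h2 : (2 : ℝ) ^ (n * (E + ε) * k) *
          ((A (n * k + r) * tprod (blockPow ω k) (tpow σ r)).trace).re ≤
          2 ^ (-(r * (E + ε))) := by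
        refine (mul_le_mul_of_nonneg_left hacc (by positivity)).trans_eq ?_
        rw [← Real.rpow_add two_pos]
        congr 1
        push_cast
        ring
      simp only [hF]
      linarith
    refine (key (N / n) (N % n) (Nat.div_add_mod N n)).trans ?_
    refine mul_le_mul_of_nonneg_right ?_ (pow_nonneg hc0 _)
    exact Finset.single_le_sum (fun r _ => hF0 r) (Finset.mem_range.mpr (Nat.mod_lt N hn))
  have hzero : Tendsto (fun N => ((A N * tpow ρ N).trace).re) atTop (nhds 0) := by
    have hdiv : Tendsto (fun N : ℕ => N / n) atTop atTop := Nat.tendsto_div_const_atTop hn.ne'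
    have hlim : Tendsto (fun N => (∑ r ∈ Finset.range n, F r) * c ^ (N / n)) atTop (nhds 0) := by
      simpa using ((tendsto_pow_atTop_nhds_zero_of_lt_one hc0 hc1).comp hdiv).const_mul
        (∑ r ∈ Finset.range n, F r)
    refine squeeze_zero' (Eventually.of_forall fun N => ?_) ?_ hlim
    · exact re_trace_mul_nonneg (hA N).1 (tpow_isState hρ N).1
    · filter_upwards [eventually_ge_atTop n] with N hN using hbound N hN
  have hone : ∀ N, (((1 - A N) * tpow ρ N).trace).re = 1 - ((A N * tpow ρ N).trace).re := by
    intro N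
    rw [Matrix.sub_mul, Matrix.one_mul, Matrix.trace_sub, (tpow_isState hρ N).2, Complex.sub_re,
      Complex.one_re]
  simp only [hone]
  simpa using hzero.const_sub 1

end GQSL
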